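/- Under Condition (A) (nQ₁(n) = o(Q₂(n))), for any s₁, s₂ ∈ (0,1) and any a ∈ (0,1), one has lim_{n→∞} E[s₁^{Z₁(⌊an⌋,n)} s₂^{Z₂(⌊an⌋,n)} | Z(n) ≠ 0, Z(0)=e₂] = 1 - (a + (1-a)(1-s₂)^{-α₂})^{-1/α₂}. -/

import Mathlib

open MeasureTheory Filter Topology

/-- `a(n) ~ b(n)` : the ratio tends to `1` as `n → ∞`. -/
def Asymp (f g : ℕ → ℝ) : Prop :=
  Filter.Tendsto (fun n => f n / g n) Filter.atTop (nhds 1)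

/-- A critical decomposable two-type Galton–Watson process together with its
reduced process.  `P1` is the law of the process started from one particle of
type 1 (`Z(0) = e₁`), `P2` the law started from one particle of type 2
(`Z(0) = e₂`).  `Z1 n`/`Z2 n` are the numbers of particles of types 1 and 2 at
time `n`; `R1 m n`/`R2 m n` are the numbers of particles of types 1 and 2 alive
at time `m` having descendants at time `n` (the reduced process). -/
structure GWSetup where
  (Ω : Type)
  [mΩ : MeasurableSpace Ω]
  (P1 : Measure Ω)
  (P2 : Measure Ω)
  (hprob1 : IsProbabilityMeasure P1)
  (hprob2 : IsProbabilityMeasure P2)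
  (Z1 : ℕ → Ω → ℕ)
  (Z2 : ℕ → Ω → ℕ)
  (R1 : ℕ → ℕ → Ω → ℕ)
  (R2 : ℕ → ℕ → Ω → ℕ)
  (mZ1 : ∀ n, Measurable (Z1 n))
  (mZ2 : ∀ n, Measurable (Z2 n))
  (mR1 : ∀ m n, Measurable (R1 m n))
  (mR2 : ∀ m n, Measurable (R2 m n))
  (α1 : ℝ)
  (α2 : ℝ)
  (A21 : ℝ)
  (L1 : ℝ → ℝ)
  (L2 : ℝ → ℝ)
  (ρ : ℝ → ℝ → ℝ)
  (hα1 : 0 < α1 ∧ α1 ≤ 1)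
  (hα2 : 0 < α2 ∧ α2 ≤ 1)
  (hA21 : 0 < A21)
  -- initial states
  (hinit1 : ∀ᵐ ω ∂P1, Z1 0 ω = 1 ∧ Z2 0 ω = 0)
  (hinit2 : ∀ᵐ ω ∂P2, Z1 0 ω = 0 ∧ Z2 0 ω = 1)
  -- type-1 particles produce only type-1 particles
  (hdecomp : ∀ n, ∀ᵐ ω ∂P1, Z2 n ω = 0)
  -- criticality
  (hcrit1 : (∫ ω, (Z1 1 ω : ℝ) ∂P1) = 1)
  (hcrit2 : (∫ ω, (Z2 1 ω : ℝ) ∂P2) = 1)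
  -- mean number of type-1 children of a type-2 particle
  (hmean21 : (∫ ω, (Z1 1 ω : ℝ) ∂P2) = A21)
  -- assumption (F1)
  (hF1 : ∀ s : ℝ, 0 ≤ s → s < 1 →
    (∫ ω, s ^ Z1 1 ω ∂P1) = s + (1 - s) ^ (1 + α1) * L1 (1 - s))
  -- assumption (F2)
  (hF2 : ∀ s1 s2 : ℝ, 0 ≤ s1 → s1 ≤ 1 → 0 ≤ s2 → s2 < 1 →
    (∫ ω, s1 ^ Z1 1 ω * s2 ^ Z2 1 ω ∂P2) =
      s2 + (1 - s2) ^ (1 + α2) * L2 (1 - s2) - (A21 - ρ s1 s2) * (1 - s1))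
  -- `L1`, `L2` are slowly varying at `0`
  (hL1 : ∀ c : ℝ, 0 < c →
    Filter.Tendsto (fun x => L1 (c * x) / L1 x) (nhdsWithin 0 (Set.Ioi 0)) (nhds 1))
  (hL2 : ∀ c : ℝ, 0 < c →
    Filter.Tendsto (fun x => L2 (c * x) / L2 x) (nhdsWithin 0 (Set.Ioi 0)) (nhds 1))
  -- `ρ(s₁,s₂) → 0` as `s₁ s₂ ↑ 1`
  (hρ : ∀ ε : ℝ, 0 < ε → ∃ δ : ℝ, 0 < δ ∧ ∀ s1 s2 : ℝ,
    0 ≤ s1 → s1 ≤ 1 → 0 ≤ s2 → s2 ≤ 1 → 1 - δ < s1 * s2 → |ρ s1 s2| < ε)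
  -- branching (semigroup) property at the level of generating functions
  (hbranch1 : ∀ m n : ℕ, ∀ s : ℝ, 0 ≤ s → s ≤ 1 →
    (∫ ω, s ^ Z1 (m + n) ω ∂P1) = ∫ ω, (∫ ω', s ^ Z1 n ω' ∂P1) ^ Z1 m ω ∂P1)
  (hbranch2 : ∀ m n : ℕ, ∀ s1 s2 : ℝ, 0 ≤ s1 → s1 ≤ 1 → 0 ≤ s2 → s2 ≤ 1 →
    (∫ ω, s1 ^ Z1 (m + n) ω * s2 ^ Z2 (m + n) ω ∂P2) =
      ∫ ω, (∫ ω', s1 ^ Z1 n ω' ∂P1) ^ Z1 m ω *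
        (∫ ω', s1 ^ Z1 n ω' * s2 ^ Z2 n ω' ∂P2) ^ Z2 m ω ∂P2)
  -- the reduced process vanishes on the extinction event
  (hext : ∀ m n : ℕ, ∀ᵐ ω ∂P2,
    (Z1 n ω = 0 ∧ Z2 n ω = 0) → (R1 m n ω = 0 ∧ R2 m n ω = 0))
  -- the generating function of the reduced process (conditioning on `Z(m)`)
  (hreduced : ∀ m n : ℕ, m ≤ n → ∀ s1 s2 : ℝ, 0 ≤ s1 → s1 ≤ 1 → 0 ≤ s2 → s2 ≤ 1 →
    (∫ ω, s1 ^ R1 m n ω * s2 ^ R2 m n ω ∂P2) =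
      ∫ ω, (1 - (1 - s1) * (P1 {ω' | Z1 (n - m) ω' ≠ 0}).toReal) ^ Z1 m ω *
        (1 - (1 - s2) *
          (P2 {ω' | Z1 (n - m) ω' ≠ 0 ∨ Z2 (n - m) ω' ≠ 0}).toReal) ^ Z2 m ω ∂P2)

namespace GWSetup

variable (S : GWSetup)

/-- The survival event `{Z(n) ≠ 0}` (under the law `P2`). -/
def surv (n : ℕ) : Set S.Ω := {ω | S.Z1 n ω ≠ 0 ∨ S.Z2 n ω ≠ 0}

/-- `Q₁(n) = P(Z₁(n) > 0 | Z(0) = e₁)`. -/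
noncomputable def Q1 (n : ℕ) : ℝ := (S.P1 {ω | S.Z1 n ω ≠ 0}).toReal

/-- `Q₂(n) = P(Z₂(n) > 0 | Z(0) = e₂)`. -/
noncomputable def Q2 (n : ℕ) : ℝ := (S.P2 {ω | S.Z2 n ω ≠ 0}).toReal

/-- `Q₂₁(n) = P(Z(n) ≠ 0 | Z(0) = e₂)`. -/
noncomputable def Q21 (n : ℕ) : ℝ := (S.P2 (S.surv n)).toReal

/-- `F₁(n; s) = E[s^{Z₁(n)} | Z(0) = e₁]`. -/
noncomputable def F1 (n : ℕ) (s : ℝ) : ℝ := ∫ ω, s ^ S.Z1 n ω ∂S.P1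

/-- `F₂₁(n; s₁, s₂) = E[s₁^{Z₁(n)} s₂^{Z₂(n)} | Z(0) = e₂]`. -/
noncomputable def F21 (n : ℕ) (s1 s2 : ℝ) : ℝ :=
  ∫ ω, s1 ^ S.Z1 n ω * s2 ^ S.Z2 n ω ∂S.P2

/-- `Q₁(n; s) = 1 - F₁(n; s)`. -/
noncomputable def Q1s (n : ℕ) (s : ℝ) : ℝ := 1 - S.F1 n s

/-- `Q₂(n; s) = 1 - E[s^{Z₂(n)} | Z(0) = e₂]`. -/
noncomputable def Q2s (n : ℕ) (s : ℝ) : ℝ := 1 - S.F21 n 1 s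

/-- `Q₂₁(n; s₁, s₂) = 1 - F₂₁(n; s₁, s₂)`. -/
noncomputable def Q21s (n : ℕ) (s1 s2 : ℝ) : ℝ := 1 - S.F21 n s1 s2

/-- The conditional expectation
`E[f(Z₁(m,n), Z₂(m,n)) | Z(n) ≠ 0, Z(0) = e₂]` for the reduced process. -/
noncomputable def Ered (m n : ℕ) (f : ℕ → ℕ → ℝ) : ℝ :=
  (∫ ω in S.surv n, f (S.R1 m n ω) (S.R2 m n ω) ∂S.P2) / S.Q21 n

/-- The conditional probability `P(E | Z(n) ≠ 0, Z(0) = e₂)`. -/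
noncomputable def Pred (n : ℕ) (E : Set S.Ω) : ℝ :=
  (S.P2 (E ∩ S.surv n)).toReal / S.Q21 n

/-- The birth time `β_n` of the most recent common ancestor of the population
alive at time `n`:  `β_n = max {m < n : Z₁(m,n) + Z₂(m,n) = 1}`. -/
noncomputable def beta (n : ℕ) (ω : S.Ω) : ℕ :=
  sSup {m | m < n ∧ S.R1 m n ω + S.R2 m n ω = 1}

/-- The type `T_n` of the most recent common ancestor: the `i ∈ {1,2}` with
`Z_i(β_n, n) = 1`. -/
noncomputable def mrcaType (n : ℕ) (ω : S.Ω) : ℕ :=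
  if S.R2 (S.beta n ω) n ω = 1 then 2 else 1

/-- Condition (A): `n Q₁(n) = o(Q₂(n))`. -/
def CondA : Prop :=
  Filter.Tendsto (fun n : ℕ => (n : ℝ) * S.Q1 n / S.Q2 n) Filter.atTop (nhds 0)

/-- Condition (B): `Q₂(n) = o(n Q₁(n))`. -/
def CondB : Prop :=
  Filter.Tendsto (fun n : ℕ => S.Q2 n / ((n : ℝ) * S.Q1 n)) Filter.atTop (nhds 0)

/-- Condition (C): `n Q₁(n) ~ σ Q₂(n)`. -/
def CondC (σ : ℝ) : Prop := Asymp (fun n : ℕ => (n : ℝ) * S.Q1 n) (fun n => σ * S.Q2 n)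

/-- `h*` is an integer-valued function with
`(α₁ A₂₁ / (1 - α₁)) h*(n) Q₁(h*(n)) ~ Q₂(n)`. -/
def IsHStar (h : ℕ → ℕ) : Prop :=
  Asymp (fun n : ℕ => S.α1 * S.A21 / (1 - S.α1) * (h n : ℝ) * S.Q1 (h n)) S.Q2

/-- `g*` is an integer-valued function with `Q₂(g*(n)) ~ Q₂₁(n)`. -/
def IsGStar (g : ℕ → ℕ) : Prop := Asymp (fun n => S.Q2 (g n)) S.Q21

end GWSetup

/-- The map `x ↦ x - g x`. -/
def critStep (g : ℝ → ℝ) (x : ℝ) : ℝ := x - g x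

/-- The rescaled inverse rate `x / (α g x)`, which grows by about one at each application of
`critStep g`. -/
noncomputable def invRate (g : ℝ → ℝ) (α : ℝ) (x : ℝ) : ℝ := x / (α * g x)

/-- Convex perturbations of the identity on `[0, 1]` that are regularly varying at `0` with
index `1 + α`. -/
structure CritPert (g : ℝ → ℝ) (α : ℝ) : Prop where
  pos : 0 < α
  zero : g 0 = 0
  nonneg : ∀ x ∈ Set.Icc (0 : ℝ) 1, 0 ≤ g x
  conv : ConvexOn ℝ (Set.Icc 0 1) g
  monoStep : MonotoneOn (critStep g) (Set.Icc 0 1)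
  rv : ∀ c : ℝ, 0 < c → Tendsto (fun x => g (c * x) / g x) (𝓝[>] 0) (𝓝 (c ^ (1 + α)))

theorem eventually_nhdsGT_zero_Ioc {b : ℝ} (hb : 0 < b) : ∀ᶠ x in 𝓝[>] (0 : ℝ), x ∈ Set.Ioc 0 b :=
  Ioc_mem_nhdsGT hb

theorem tendsto_const_mul_nhdsGT_zero {c : ℝ} (hc : 0 < c) :
    Tendsto (fun x => c * x) (𝓝[>] (0 : ℝ)) (𝓝[>] 0) := by
  refine tendsto_nhdsWithin_iff.2 ⟨?_, ?_⟩
  · have : Tendsto (fun x : ℝ => c * x) (𝓝 0) (𝓝 (c * 0)) := tendsto_id.const_mul c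
    rw [mul_zero] at this
    exact this.mono_left nhdsWithin_le_nhds
  · filter_upwards [self_mem_nhdsWithin] with x hx
    exact mul_pos hc hx

namespace CritPert

variable {g : ℝ → ℝ} {α : ℝ}

theorem div_le_div (h : CritPert g α) {x y : ℝ} (hx : 0 < x) (hxy : x ≤ y) (hy : y ≤ 1) :
    g x / x ≤ g y / y := by
  have hy0 : 0 < y := hx.trans_le hxy
  have hxy1 : 0 ≤ 1 - x / y := by rwa [sub_nonneg, div_le_one hy0]
  have key := h.conv.2 ⟨le_rfl, zero_le_one⟩ ⟨hy0.le, hy⟩ hxy1 (div_nonneg hx.le hy0.le)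
    (sub_add_cancel 1 (x / y))
  simp only [smul_eq_mul, mul_zero, zero_add, h.zero] at key
  rw [div_mul_cancel₀ _ hy0.ne'] at key
  rw [div_le_iff₀ hx]
  calc g x ≤ x / y * g y := key
    _ = g y / y * x := by ring

theorem mono (h : CritPert g α) : MonotoneOn g (Set.Icc 0 1) := by
  intro x hx y hy hxy
  rcases hx.1.eq_or_lt with h0 | h0
  · rw [← h0, h.zero]; exact h.nonneg y hy
  · have h1 := h.div_le_div h0 hxy hy.2
    have hy0 : 0 < y := h0.trans_le hxy
    rw [div_le_div_iff₀ h0 hy0] at h1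
    have h2 := h.nonneg y hy
    nlinarith

theorem g_pos (h : CritPert g α) {x : ℝ} (hx : x ∈ Set.Ioc (0 : ℝ) 1) : 0 < g x := by
  have h1 := (h.rv 1 one_pos).eventually_ne
    (Real.rpow_pos_of_pos one_pos (1 + α)).ne'
  obtain ⟨y, hy, hy'⟩ := (h1.and (eventually_nhdsGT_zero_Ioc hx.1)).exists
  have hy1 : y ∈ Set.Icc (0 : ℝ) 1 := ⟨hy'.1.le, hy'.2.trans hx.2⟩
  have : g y ≠ 0 := by
    intro h0; simp [h0] at hy
  exact ((h.nonneg y hy1).lt_of_ne this.symm).trans_le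
    (h.mono hy1 ⟨hx.1.le, hx.2⟩ hy'.2)

theorem rate_tendsto_zero (h : CritPert g α) : Tendsto (fun x => g x / x) (𝓝[>] 0) (𝓝 0) := by
  have hm : MonotoneOn (fun x => g x / x) (Set.Ioo 0 1) := fun x hx y hy hxy =>
    h.div_le_div hx.1 hxy hy.2.le
  have hb : BddBelow ((fun x => g x / x) '' Set.Ioo 0 1) := by
    refine ⟨0, ?_⟩
    rintro _ ⟨x, hx, rfl⟩
    exact div_nonneg (h.nonneg x ⟨hx.1.le, hx.2.le⟩) hx.1.le
  have hl := hm.tendsto_nhdsWithin_Ioo_right (Set.nonempty_Ioo.2 one_pos) hb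
  set l := sInf ((fun x => g x / x) '' Set.Ioo 0 1)
  suffices hl0 : l = 0 by rwa [hl0] at hl
  by_contra hne
  have h2 := (hl.comp (tendsto_const_mul_nhdsGT_zero (c := 2) two_pos)).div hl hne
  rw [div_self hne] at h2
  have h3 := (h.rv 2 two_pos).div_const 2
  have h4 : (2 : ℝ) ^ (1 + α) / 2 = 1 := by
    refine tendsto_nhds_unique h3 (h2.congr' ?_)
    filter_upwards [eventually_nhdsGT_zero_Ioc one_pos] with x hx
    have := (h.g_pos hx).ne'
    have := hx.1.ne'
    simp only [Function.comp, Pi.div_apply]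
    field_simp
  rw [Real.rpow_add two_pos, Real.rpow_one] at h4
  have h5 := Real.one_lt_rpow (x := 2) (z := α) one_lt_two h.pos
  linarith

theorem tendsto_ratio (h : CritPert g α) {ι : Type*} {l : Filter ι} {u w : ι → ℝ}
    (hu : Tendsto u l (𝓝[>] 0)) {c : ℝ} (hc : 0 < c)
    (hw : Tendsto (fun i => w i / u i) l (𝓝 c)) :
    Tendsto (fun i => g (w i) / g (u i)) l (𝓝 (c ^ (1 + α))) := by
  have hu1 := hu.eventually (eventually_nhdsGT_zero_Ioc one_pos)
  have hw0 : Tendsto w l (𝓝 0) := by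
    have := hw.mul (tendsto_nhdsWithin_iff.1 hu).1
    rw [mul_zero] at this
    refine this.congr' ?_
    filter_upwards [hu1] with i hi
    exact div_mul_cancel₀ _ hi.1.ne'
  have hw1 : ∀ᶠ i in l, w i ≤ 1 := hw0.eventually_le_const one_pos
  have hcont : Tendsto (fun x : ℝ => x ^ (1 + α)) (𝓝 c) (𝓝 (c ^ (1 + α))) :=
    (Real.continuousAt_rpow_const c (1 + α) (Or.inl hc.ne'))
  rw [tendsto_order]
  constructor
  · intro b hb
    have e1 : ∀ᶠ x in 𝓝[<] c, b < x ^ (1 + α) :=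
      (hcont.eventually_const_lt hb).filter_mono nhdsWithin_le_nhds
    obtain ⟨c', hb', hc'⟩ := (e1.and (Ioo_mem_nhdsLT hc)).exists
    filter_upwards [hu1, hw1, hw.eventually_const_lt hc'.2,
      ((h.rv c' hc'.1).comp hu).eventually_const_lt hb'] with i h1 h2 h3 h4
    rw [lt_div_iff₀ h1.1] at h3
    have hcu : 0 ≤ c' * u i := mul_nonneg hc'.1.le h1.1.le
    refine h4.trans_le ?_
    exact div_le_div_of_nonneg_right
      (h.mono ⟨hcu, h3.le.trans h2⟩ ⟨hcu.trans h3.le, h2⟩ h3.le) (h.g_pos h1).le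
  · intro b hb
    have e1 : ∀ᶠ x in 𝓝[>] c, x ^ (1 + α) < b :=
      (hcont.eventually_lt_const hb).filter_mono nhdsWithin_le_nhds
    obtain ⟨c', hb', hc'⟩ := (e1.and self_mem_nhdsWithin).exists
    have hc'0 : 0 < c' := hc.trans hc'
    have hcu1 := ((tendsto_const_mul_nhdsGT_zero hc'0).comp hu).eventually
      (eventually_nhdsGT_zero_Ioc one_pos)
    filter_upwards [hu1, hcu1, hw.eventually_lt_const hc', hw.eventually_const_lt hc,
      ((h.rv c' hc'0).comp hu).eventually_lt_const hb'] with i h1 h2 h3 h5 h4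
    rw [div_lt_iff₀ h1.1] at h3
    have hw0 : 0 < w i := by
      have := mul_pos h5 h1.1
      rwa [div_mul_cancel₀ _ h1.1.ne'] at this
    refine lt_of_le_of_lt ?_ h4
    exact div_le_div_of_nonneg_right
      (h.mono ⟨hw0.le, h3.le.trans h2.2⟩ ⟨h2.1.le, h2.2⟩ h3.le) (h.g_pos h1).le

theorem step_div_tendsto (h : CritPert g α) :
    Tendsto (fun x => critStep g x / x) (𝓝[>] 0) (𝓝 1) := by
  have := h.rate_tendsto_zero.const_sub 1
  rw [sub_zero] at this
  refine this.congr' ?_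
  filter_upwards [self_mem_nhdsWithin] with x hx
  have : x ≠ 0 := (Set.mem_Ioi.1 hx).ne'
  simp only [critStep]
  field_simp

theorem step_zero (h : CritPert g α) : critStep g 0 = 0 := by simp [critStep, h.zero]

theorem step_pos (h : CritPert g α) {x : ℝ} (hx : x ∈ Set.Ioc (0 : ℝ) 1) :
    0 < critStep g x := by
  obtain ⟨y, hy, hy'⟩ := ((h.step_div_tendsto.eventually_const_lt one_pos).and
    (eventually_nhdsGT_zero_Ioc hx.1)).exists
  have : 0 < critStep g y := by
    have := mul_pos hy hy'.1
    rwa [div_mul_cancel₀ _ hy'.1.ne'] at this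
  exact this.trans_le (h.monoStep ⟨hy'.1.le, hy'.2.trans hx.2⟩ ⟨hx.1.le, hx.2⟩ hy'.2)

theorem step_lt (h : CritPert g α) {x : ℝ} (hx : x ∈ Set.Ioc (0 : ℝ) 1) :
    critStep g x < x := sub_lt_self _ (h.g_pos hx)

theorem step_le (h : CritPert g α) {x : ℝ} (hx : x ∈ Set.Icc (0 : ℝ) 1) :
    critStep g x ≤ x := sub_le_self _ (h.nonneg x hx)

theorem step_mem_Icc (h : CritPert g α) {b x : ℝ} (hb : b ≤ 1) (hx : x ∈ Set.Icc (0 : ℝ) b) :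
    critStep g x ∈ Set.Icc (0 : ℝ) b := by
  have hx' : x ∈ Set.Icc (0 : ℝ) 1 := ⟨hx.1, hx.2.trans hb⟩
  refine ⟨?_, (h.step_le hx').trans hx.2⟩
  rw [← h.step_zero]
  exact h.monoStep ⟨le_rfl, zero_le_one⟩ hx' hx.1

theorem iterate_mem_Icc (h : CritPert g α) {b x : ℝ} (hb : b ≤ 1) (hx : x ∈ Set.Icc (0 : ℝ) b)
    (m : ℕ) : (critStep g)^[m] x ∈ Set.Icc (0 : ℝ) b := by
  induction m with
  | zero => exact hx
  | succ m ih => rw [Function.iterate_succ_apply']; exact h.step_mem_Icc hb ih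

theorem iterate_mem_Ioc (h : CritPert g α) {b x : ℝ} (hb : b ≤ 1) (hx : x ∈ Set.Ioc (0 : ℝ) b)
    (m : ℕ) : (critStep g)^[m] x ∈ Set.Ioc (0 : ℝ) b := by
  induction m with
  | zero => exact hx
  | succ m ih =>
    rw [Function.iterate_succ_apply']
    exact ⟨h.step_pos ⟨ih.1, ih.2.trans hb⟩, (h.step_lt ⟨ih.1, ih.2.trans hb⟩).le.trans ih.2⟩

theorem step_le_add (h : CritPert g α) {q u v : ℝ} (hq : q ∈ Set.Icc (0 : ℝ) 1)
    (hu : u ∈ Set.Icc (0 : ℝ) 1) (hv : 0 ≤ v) (hquv : q ≤ u + v) :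
    critStep g q ≤ critStep g u + v := by
  rcases le_total q u with hqu | hqu
  · linarith [h.monoStep hq hu hqu]
  · have := h.mono hu hq hqu
    simp only [critStep]
    linarith

theorem le_iterate_add (h : CritPert g α) {q : ℕ → ℝ} {e : ℝ} (he : 0 ≤ e)
    (hq : ∀ i, q i ∈ Set.Icc (0 : ℝ) 1) (hrec : ∀ i, q (i + 1) ≤ critStep g (q i) + e) (j : ℕ) :
    q j ≤ (critStep g)^[j] (q 0) + j * e := by
  induction j with
  | zero => simp
  | succ j ih =>
    rw [Function.iterate_succ_apply']
    have := h.step_le_add (hq j) (h.iterate_mem_Icc le_rfl (hq 0) j) (by positivity) ih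
    push_cast
    linarith [hrec j]

/-! ### The inverse rate -/

theorem invRate_pos (h : CritPert g α) {x : ℝ} (hx : x ∈ Set.Ioc (0 : ℝ) 1) :
    0 < invRate g α x :=
  div_pos hx.1 (mul_pos h.pos (h.g_pos hx))

theorem invRate_anti (h : CritPert g α) {x y : ℝ} (hx : 0 < x) (hxy : x ≤ y) (hy : y ≤ 1) :
    invRate g α y ≤ invRate g α x := by
  have h1 := h.div_le_div hx hxy hy
  have hy0 : 0 < y := hx.trans_le hxy
  have hgx := h.g_pos ⟨hx, hxy.trans hy⟩
  have hgy := h.g_pos ⟨hy0, hy⟩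
  rw [div_le_div_iff₀ hx hy0] at h1
  unfold invRate
  rw [div_le_div_iff₀ (mul_pos h.pos hgy) (mul_pos h.pos hgx)]
  have := h.pos
  nlinarith

theorem invRate_ratio (h : CritPert g α) {ι : Type*} {l : Filter ι} {u w : ι → ℝ}
    (hu : Tendsto u l (𝓝[>] 0)) {c : ℝ} (hc : 0 < c)
    (hw : Tendsto (fun i => w i / u i) l (𝓝 c)) :
    Tendsto (fun i => invRate g α (w i) / invRate g α (u i)) l (𝓝 (c ^ (-α))) := by
  have h1 := hw.div (h.tendsto_ratio hu hc hw) (Real.rpow_pos_of_pos hc _).ne'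
  have h2 : c / c ^ (1 + α) = c ^ (-α) := by
    rw [Real.rpow_add hc, Real.rpow_one, Real.rpow_neg hc.le]
    field_simp
  rw [h2] at h1
  refine h1.congr' ?_
  filter_upwards [hu.eventually (eventually_nhdsGT_zero_Ioc one_pos)] with i hi
  have := (h.g_pos hi).ne'
  have := hi.1.ne'
  have := h.pos.ne'
  simp only [Pi.div_apply, invRate]
  field_simp

theorem slope_tendsto (h : CritPert g α) :
    Tendsto (fun x => x / g x * ((g (critStep g x) - g x) / (critStep g x - x)))
      (𝓝[>] 0) (𝓝 (1 + α)) := by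
  have hd : Tendsto (slope (fun x : ℝ => x ^ (1 + α)) 1) (𝓝[≠] 1) (𝓝 (1 + α)) := by
    have := (Real.hasDerivAt_rpow_const (x := 1) (p := 1 + α) (Or.inl one_ne_zero))
    simpa using hasDerivAt_iff_tendsto_slope.1 this
  have hsl : ∀ c : ℝ, 0 < c → Tendsto (fun x => x / g x * ((g (c * x) - g x) / (c * x - x)))
      (𝓝[>] 0) (𝓝 (slope (fun x : ℝ => x ^ (1 + α)) 1 c)) := by
    intro c hc
    have h1 := ((h.rv c hc).sub_const 1).div_const (c - 1)
    rw [slope_def_field, Real.one_rpow]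
    refine h1.congr' ?_
    filter_upwards [eventually_nhdsGT_zero_Ioc one_pos] with x hx
    have h1 := (h.g_pos hx).ne'
    have h2 := hx.1.ne'
    rw [show c * x - x = (c - 1) * x by ring]
    by_cases hc1 : c - 1 = 0
    · simp [hc1]
    · field_simp
  rw [tendsto_order]
  constructor
  · intro b hb
    have e1 := (hd.mono_left (nhdsLT_le_nhdsNE 1)).eventually_const_lt hb
    obtain ⟨c, hbc, hc⟩ := (e1.and (Ioo_mem_nhdsLT one_pos)).exists
    filter_upwards [(hsl c hc.1).eventually_const_lt hbc, eventually_nhdsGT_zero_Ioc one_pos,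
      h.step_div_tendsto.eventually_const_lt hc.2] with x h1 hx h3
    rw [lt_div_iff₀ hx.1] at h3
    have hlt := h.step_lt hx
    refine h1.trans_le (mul_le_mul_of_nonneg_left ?_ (div_pos hx.1 (h.g_pos hx)).le)
    have hcx := mul_pos hc.1 hx.1
    have hx1 := hx.2
    exact h.conv.secant_mono ⟨hx.1.le, hx.2⟩ ⟨hcx.le, by linarith⟩
      ⟨(h.step_pos hx).le, by linarith⟩ (by linarith) hlt.ne h3.le
  · intro b hb
    have e1 := (hd.mono_left (nhdsGT_le_nhdsNE 1)).eventually_lt_const hb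
    obtain ⟨c, hbc, hc⟩ := (e1.and self_mem_nhdsWithin).exists
    have hc1 : 1 < c := hc
    have hc0 : 0 < c := one_pos.trans hc1
    filter_upwards [(hsl c hc0).eventually_lt_const hbc, eventually_nhdsGT_zero_Ioc one_pos,
      (tendsto_const_mul_nhdsGT_zero hc0).eventually (eventually_nhdsGT_zero_Ioc one_pos)]
      with x h1 hx h3
    have hlt := h.step_lt hx
    refine lt_of_le_of_lt (mul_le_mul_of_nonneg_left ?_ (div_pos hx.1 (h.g_pos hx)).le) h1
    have hx1 := hx.2
    have : x < c * x := by nlinarith [hx.1]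
    exact h.conv.secant_mono ⟨hx.1.le, hx.2⟩ ⟨(h.step_pos hx).le, by linarith⟩
      ⟨h3.1.le, h3.2⟩ hlt.ne this.ne' (hlt.trans this).le

theorem invRate_step_sub (h : CritPert g α) :
    Tendsto (fun x => invRate g α (critStep g x) - invRate g α x) (𝓝[>] 0) (𝓝 1) := by
  have hid : Tendsto (fun x : ℝ => x) (𝓝[>] 0) (𝓝[>] 0) := tendsto_id
  have h1 := h.tendsto_ratio hid one_pos h.step_div_tendsto
  rw [Real.one_rpow] at h1
  have h2 := ((h.slope_tendsto.sub_const 1).div h1 one_ne_zero).div_const α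
  have h3 : (1 + α - 1) / 1 / α = 1 := by
    have := h.pos.ne'
    field_simp
    ring
  rw [h3] at h2
  refine h2.congr' ?_
  filter_upwards [eventually_nhdsGT_zero_Ioc one_pos] with x hx
  have a1 := (h.g_pos hx).ne'
  have a2 := (h.g_pos ⟨h.step_pos hx, (h.step_lt hx).le.trans hx.2⟩).ne'
  have a3 := h.pos.ne'
  simp only [Pi.div_apply, invRate]
  have a4 : critStep g x - x = - g x := by simp [critStep]
  rw [a4]
  generalize hy : g (critStep g x) = y at *
  simp only [critStep]
  field_simp
  ring

theorem invRate_iterate_bound (h : CritPert g α) {ε : ℝ} (hε : 0 < ε) :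
    ∃ δ ∈ Set.Ioc (0 : ℝ) 1, ∀ y ∈ Set.Ioc (0 : ℝ) δ, ∀ m : ℕ,
      |invRate g α ((critStep g)^[m] y) - invRate g α y - m| ≤ ε * m := by
  have h1 := (h.invRate_step_sub.eventually (Metric.ball_mem_nhds 1 hε)).and
    (eventually_nhdsGT_zero_Ioc one_pos)
  obtain ⟨δ, hδ0, hδ⟩ := mem_nhdsGT_iff_exists_Ioc_subset.1 h1
  have hδ0 : 0 < δ := hδ0
  have hδ1 : δ ≤ 1 := (hδ ⟨hδ0, le_rfl⟩).2.2
  refine ⟨δ, ⟨hδ0, hδ1⟩, fun y hy m => ?_⟩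
  induction m with
  | zero => simp
  | succ m ih =>
    have h2 := (hδ (h.iterate_mem_Ioc hδ1 hy m)).1
    simp only [Real.dist_eq] at h2
    rw [Function.iterate_succ_apply']
    push_cast
    rw [abs_le] at ih ⊢
    rw [abs_lt] at h2
    constructor <;> linarith [ih.1, ih.2, h2.1, h2.2]

theorem invRate_iterate_tendsto (h : CritPert g α) {y : ℕ → ℝ} (hy : Tendsto y atTop (𝓝[>] 0))
    {m : ℕ → ℕ} {μ : ℝ} (hm : Tendsto (fun n : ℕ => (m n : ℝ) / n) atTop (𝓝 μ)) :
    Tendsto (fun n : ℕ => (invRate g α ((critStep g)^[m n] (y n)) - invRate g α (y n)) / n)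
      atTop (𝓝 μ) := by
  suffices hs : Tendsto (fun n : ℕ => (invRate g α ((critStep g)^[m n] (y n)) -
      invRate g α (y n) - m n) / n) atTop (𝓝 0) by
    have := hs.add hm
    rw [zero_add] at this
    refine this.congr fun n => ?_
    rw [← add_div]
    congr 1
    ring
  rw [Metric.tendsto_nhds]
  intro ε hε
  have hμ : 0 ≤ μ := ge_of_tendsto' hm fun n => by positivity
  obtain ⟨δ, hδ, hb⟩ := h.invRate_iterate_bound (ε := ε / (μ + 1)) (by positivity)
  filter_upwards [hy.eventually (eventually_nhdsGT_zero_Ioc hδ.1),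
    hm.eventually_lt_const (lt_add_one μ), eventually_gt_atTop 0] with n h1 h2 hn
  have hn : (0 : ℝ) < n := Nat.cast_pos.2 hn
  rw [Real.dist_eq, sub_zero, abs_div, Nat.abs_cast, div_lt_iff₀ hn]
  refine (hb _ h1 (m n)).trans_lt ?_
  rw [div_lt_iff₀ hn] at h2
  calc ε / (μ + 1) * m n < ε / (μ + 1) * ((μ + 1) * n) := by
        apply mul_lt_mul_of_pos_left h2 (by positivity)
    _ = ε * n := by field_simp

theorem le_of_invRate_le (h : CritPert g α) {x y : ℕ → ℝ} (hx : Tendsto x atTop (𝓝[>] 0))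
    (hy : ∀ᶠ n in atTop, y n ≤ 1) {K c : ℝ} (hK : 0 < K) (hc : K ^ (-1 / α) < c)
    (hle : ∀ᶠ n in atTop, K * invRate g α (x n) ≤ invRate g α (y n)) :
    ∀ᶠ n in atTop, y n ≤ c * x n := by
  have hc0 : 0 < c := (Real.rpow_pos_of_pos hK _).trans hc
  have hcK : c ^ (-α) < K := by
    have h1 := Real.rpow_lt_rpow_of_neg (Real.rpow_pos_of_pos hK _) hc (neg_lt_zero.2 h.pos)
    rw [← Real.rpow_mul hK.le] at h1
    have : -1 / α * -α = 1 := by have := h.pos.ne'; field_simp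
    rwa [this, Real.rpow_one] at h1
  have hr := h.invRate_ratio (w := fun n => c * x n) hx hc0 (by
    refine tendsto_const_nhds.congr' ?_
    filter_upwards [hx.eventually (eventually_nhdsGT_zero_Ioc one_pos)] with n hn
    exact (mul_div_cancel_right₀ c hn.1.ne').symm)
  filter_upwards [hr.eventually_lt_const hcK, hle, hy,
    hx.eventually (eventually_nhdsGT_zero_Ioc one_pos)] with n h1 h2 h3 h4
  by_contra! hlt
  have h5 := h.invRate_anti (mul_pos hc0 h4.1) hlt.le h3
  rw [div_lt_iff₀ (h.invRate_pos h4)] at h1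
  linarith

theorem tendsto_div_of_invRate (h : CritPert g α) {x y : ℕ → ℝ} (hx : Tendsto x atTop (𝓝[>] 0))
    (hy : Tendsto y atTop (𝓝[>] 0)) {K : ℝ} (hK : 0 < K)
    (hr : Tendsto (fun n => invRate g α (y n) / invRate g α (x n)) atTop (𝓝 K)) :
    Tendsto (fun n => y n / x n) atTop (𝓝 (K ^ (-1 / α))) := by
  have hx1 := hx.eventually (eventually_nhdsGT_zero_Ioc one_pos)
  have hy1 := hy.eventually (eventually_nhdsGT_zero_Ioc one_pos)
  have hcont : Tendsto (fun x : ℝ => x ^ (-1 / α)) (𝓝 K) (𝓝 (K ^ (-1 / α))) :=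
    Real.continuousAt_rpow_const K _ (Or.inl hK.ne')
  rw [tendsto_order]
  constructor
  · intro b hb
    rcases le_or_gt b 0 with hb0 | hb0
    · filter_upwards [hx1, hy1] with n h1 h2
      exact hb0.trans_lt (div_pos h2.1 h1.1)
    obtain ⟨K', hK', hKK'⟩ := (((hcont.eventually_const_lt hb).filter_mono
      nhdsWithin_le_nhds).and (self_mem_nhdsWithin (s := Set.Ioi K))).exists
    have hK'0 : 0 < K' := hK.trans hKK'
    obtain ⟨b', hbb', hb'K⟩ := exists_between hK'
    have hb'0 : 0 < b' := hb0.trans hbb'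
    have h1 := h.le_of_invRate_le hy (hx1.mono fun n hn => hn.2) (inv_pos.2 hK'0)
      (c := b'⁻¹) (by
        rw [Real.inv_rpow hK'0.le]
        exact inv_strictAnti₀ hb'0 hb'K) (by
        filter_upwards [hr.eventually_lt_const hKK', hx1] with n h3 h4
        rw [div_lt_iff₀ (h.invRate_pos h4)] at h3
        rw [inv_mul_le_iff₀ hK'0]
        exact h3.le)
    filter_upwards [h1, hx1] with n h2 h3
    rw [lt_div_iff₀ h3.1]
    have h4 : b' * x n ≤ y n := by rwa [← div_eq_inv_mul, le_div_iff₀' hb'0] at h2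
    nlinarith [h3.1]
  · intro b hb
    obtain ⟨K', hK', hKK'⟩ := (((hcont.eventually_lt_const hb).filter_mono
      nhdsWithin_le_nhds).and (Ioo_mem_nhdsLT hK)).exists
    obtain ⟨b', hb'K, hbb'⟩ := exists_between hK'
    have h1 := h.le_of_invRate_le hx (hy1.mono fun n hn => hn.2) hKK'.1 hb'K (by
        filter_upwards [hr.eventually_const_lt hKK'.2, hx1] with n h3 h4
        rw [lt_div_iff₀ (h.invRate_pos h4)] at h3
        exact h3.le)
    filter_upwards [h1, hx1] with n h2 h3
    rw [div_lt_iff₀ h3.1]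
    nlinarith [h3.1]


/-! ### The unperturbed orbit of `1` and perturbed recursions -/

theorem orbit_mem (h : CritPert g α) (n : ℕ) : (critStep g)^[n] 1 ∈ Set.Ioc (0 : ℝ) 1 :=
  h.iterate_mem_Ioc le_rfl ⟨one_pos, le_rfl⟩ n

/-- An antitone sequence dominated by one step of the map up to a vanishing error tends to `0`. -/
theorem tendsto_zero_of_le_step (h : CritPert g α) {q e : ℕ → ℝ} (hq : ∀ i, q i ∈ Set.Icc (0 : ℝ) 1)
    (hanti : Antitone q) (he : Tendsto e atTop (𝓝 0))
    (hrec : ∀ i, q (i + 1) ≤ critStep g (q i) + e i) : Tendsto q atTop (𝓝 0) := by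
  have hb : BddBelow (Set.range q) := ⟨0, by rintro _ ⟨i, rfl⟩; exact (hq i).1⟩
  have hl := tendsto_atTop_ciInf hanti hb
  have hle : ∀ i, iInf q ≤ q i := fun i => ciInf_le hb i
  have hl0 : 0 ≤ iInf q := le_ciInf fun i => (hq i).1
  set l := iInf q
  rcases hl0.eq_or_lt with h0 | h0
  · rwa [← h0] at hl
  exfalso
  have hl1 : l ≤ 1 := (hle 0).trans (hq 0).2
  have hgl := h.g_pos ⟨h0, hl1⟩
  have h1 : Tendsto (fun i => q i - q (i + 1) + e i) atTop (𝓝 (l - l + 0)) :=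
    (hl.sub ((tendsto_add_atTop_iff_nat 1).2 hl)).add he
  rw [sub_self, add_zero] at h1
  have h2 : g l ≤ 0 := by
    refine ge_of_tendsto' h1 fun i => ?_
    have h3 := h.mono ⟨hl0, hl1⟩ (hq i) (hle i)
    have h4 := hrec i
    simp only [critStep] at h4
    linarith
  linarith

theorem orbit_tendsto (h : CritPert g α) :
    Tendsto (fun n => (critStep g)^[n] 1) atTop (𝓝[>] 0) := by
  refine tendsto_nhdsWithin_iff.2 ⟨?_, Eventually.of_forall fun n => (h.orbit_mem n).1⟩
  refine h.tendsto_zero_of_le_step (e := fun _ => 0)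
    (fun i => ⟨(h.orbit_mem i).1.le, (h.orbit_mem i).2⟩) ?_ tendsto_const_nhds ?_
  · refine antitone_nat_of_succ_le fun n => ?_
    rw [Function.iterate_succ_apply']
    exact (h.step_lt (h.orbit_mem n)).le
  · intro i
    rw [Function.iterate_succ_apply', add_zero]

theorem invRate_orbit_tendsto (h : CritPert g α) :
    Tendsto (fun n : ℕ => invRate g α ((critStep g)^[n] 1) / n) atTop (𝓝 1) := by
  have h1 := (h.invRate_step_sub.comp h.orbit_tendsto).cesaro
  have h2 := h1.add ((tendsto_inv_atTop_nhds_zero_nat (𝕜 := ℝ)).mul_const (invRate g α 1))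
  rw [zero_mul, add_zero] at h2
  refine h2.congr fun n => ?_
  have h3 : ∑ i ∈ Finset.range n, ((fun x => invRate g α (critStep g x) - invRate g α x) ∘
      fun n => (critStep g)^[n] 1) i = invRate g α ((critStep g)^[n] 1) - invRate g α 1 := by
    have := Finset.sum_range_sub (fun i => invRate g α ((critStep g)^[i] 1)) n
    simp only [Function.iterate_succ_apply', Function.iterate_zero, id] at this
    exact this
  rw [h3]
  ring

theorem tendsto_atTop_of_div {k : ℕ → ℕ} {μ : ℝ} (hμ : 0 < μ)
    (hk : Tendsto (fun n : ℕ => (k n : ℝ) / n) atTop (𝓝 μ)) : Tendsto k atTop atTop := by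
  rw [← tendsto_natCast_atTop_iff (R := ℝ)]
  refine (hk.pos_mul_atTop hμ tendsto_natCast_atTop_atTop).congr' ?_
  filter_upwards [eventually_gt_atTop 0] with n hn
  exact div_mul_cancel₀ _ (Nat.cast_ne_zero.2 hn.ne')

theorem invRate_orbit_comp (h : CritPert g α) {k : ℕ → ℕ} {μ : ℝ} (hμ : 0 < μ)
    (hk : Tendsto (fun n : ℕ => (k n : ℝ) / n) atTop (𝓝 μ)) :
    Tendsto (fun n : ℕ => invRate g α ((critStep g)^[k n] 1) / n) atTop (𝓝 μ) := by
  have hk' := tendsto_atTop_of_div hμ hk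
  have h1 := (h.invRate_orbit_tendsto.comp hk').mul hk
  rw [one_mul] at h1
  refine h1.congr' ?_
  filter_upwards [hk'.eventually_gt_atTop 0] with n hn
  have : (k n : ℝ) ≠ 0 := Nat.cast_ne_zero.2 hn.ne'
  simp only [Function.comp]
  field_simp

theorem tendsto_div_orbit (h : CritPert g α) {y : ℕ → ℝ} (hy : Tendsto y atTop (𝓝[>] 0)) {K : ℝ}
    (hK : 0 < K) (hr : Tendsto (fun n : ℕ => invRate g α (y n) / n) atTop (𝓝 K)) :
    Tendsto (fun n => y n / (critStep g)^[n] 1) atTop (𝓝 (K ^ (-1 / α))) := by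
  refine h.tendsto_div_of_invRate h.orbit_tendsto hy hK ?_
  have := hr.div h.invRate_orbit_tendsto one_ne_zero
  rw [div_one] at this
  refine this.congr' ?_
  filter_upwards [eventually_gt_atTop 0] with n hn
  have : (n : ℝ) ≠ 0 := Nat.cast_ne_zero.2 hn.ne'
  have := (h.invRate_pos (h.orbit_mem n)).ne'
  simp only [Pi.div_apply]
  field_simp

theorem error_tendsto_zero (h : CritPert g α) {e : ℕ → ℝ}
    (he : Tendsto (fun n : ℕ => n * e n / (critStep g)^[n] 1) atTop (𝓝 0))
    {k : ℕ → ℕ} {μ : ℝ} (hμ : 0 < μ)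
    (hk : Tendsto (fun n : ℕ => (k n : ℝ) / n) atTop (𝓝 μ)) :
    Tendsto (fun n : ℕ => n * e (k n) / (critStep g)^[n] 1) atTop (𝓝 0) := by
  have hk' := tendsto_atTop_of_div hμ hk
  have h1 := h.tendsto_div_orbit (h.orbit_tendsto.comp hk') hμ (h.invRate_orbit_comp hμ hk)
  have h2 := ((he.comp hk').mul h1).div hk hμ.ne'
  rw [zero_mul, zero_div] at h2
  refine h2.congr' ?_
  filter_upwards [hk'.eventually_gt_atTop 0, eventually_gt_atTop 0] with n hn hn'
  have : (k n : ℝ) ≠ 0 := Nat.cast_ne_zero.2 hn.ne'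
  have : (n : ℝ) ≠ 0 := Nat.cast_ne_zero.2 hn'.ne'
  have := (h.orbit_mem n).1.ne'
  have := (h.orbit_mem (k n)).1.ne'
  simp only [Function.comp, Pi.div_apply]
  field_simp

theorem tendsto_floor_div {a : ℝ} (ha : 0 ≤ a) :
    Tendsto (fun n : ℕ => (⌊a * (n : ℝ)⌋₊ : ℝ) / n) atTop (𝓝 a) :=
  (tendsto_nat_floor_mul_div_atTop ha).comp tendsto_natCast_atTop_atTop

theorem floor_mul_le {a : ℝ} (ha : a ≤ 1) (n : ℕ) : ⌊a * (n : ℝ)⌋₊ ≤ n := by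
  refine Nat.floor_le_of_le ?_
  exact mul_le_of_le_one_left (Nat.cast_nonneg n) ha

theorem tendsto_sub_floor_div {a : ℝ} (ha : a ∈ Set.Icc (0 : ℝ) 1) :
    Tendsto (fun n : ℕ => ((n - ⌊a * (n : ℝ)⌋₊ : ℕ) : ℝ) / n) atTop (𝓝 (1 - a)) := by
  refine ((tendsto_floor_div ha.1).const_sub 1).congr' ?_
  filter_upwards [eventually_gt_atTop 0] with n hn
  have : (n : ℝ) ≠ 0 := Nat.cast_ne_zero.2 hn.ne'
  rw [Nat.cast_sub (floor_mul_le ha.2 n), sub_div, div_self this]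

/-- Orbits of the map perturbed by an error `e n` with `n * e n` negligible are asymptotically
bounded by the unperturbed orbit of `1`. -/
theorem perturbed_le (h : CritPert g α) {q e : ℕ → ℝ} (hq : ∀ i, q i ∈ Set.Icc (0 : ℝ) 1)
    (hq0 : Tendsto q atTop (𝓝[>] 0)) (he0 : ∀ i, 0 ≤ e i) (hanti : Antitone e)
    (hrec : ∀ i, q (i + 1) ≤ critStep g (q i) + e i)
    (he : Tendsto (fun n : ℕ => n * e n / (critStep g)^[n] 1) atTop (𝓝 0)) {b : ℝ} (hb : 1 < b) :
    ∀ᶠ n in atTop, q n ≤ b * (critStep g)^[n] 1 := by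
  obtain ⟨b', hb1, hbb'⟩ := exists_between hb
  have hcont : Tendsto (fun x : ℝ => (1 - 2 * x) ^ (-1 / α)) (𝓝 0) (𝓝 1) := by
    have : ContinuousAt (fun x : ℝ => (1 - 2 * x) ^ (-1 / α)) 0 :=
      ContinuousAt.rpow_const (by fun_prop) (Or.inl (by norm_num))
    simpa [ContinuousAt] using this
  obtain ⟨ε, hε1, hε⟩ := (((hcont.eventually_lt_const hb1).filter_mono
    nhdsWithin_le_nhds).and (Ioo_mem_nhdsGT (show (0 : ℝ) < 1 / 2 by norm_num))).exists
  have hε' : ε ∈ Set.Icc (0 : ℝ) 1 := ⟨hε.1.le, by linarith [hε.2]⟩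
  have hfl := tendsto_floor_div hε.1.le
  have hqk := hq0.comp (tendsto_atTop_of_div hε.1 hfl)
  have h1 := h.invRate_iterate_tendsto hqk (tendsto_sub_floor_div hε')
  have h2 : ∀ᶠ n : ℕ in atTop, (1 - 2 * ε) * invRate g α ((critStep g)^[n] 1) ≤
      invRate g α ((critStep g)^[n - ⌊ε * (n : ℝ)⌋₊] (q ⌊ε * (n : ℝ)⌋₊)) := by
    have h3 := h1.sub (h.invRate_orbit_tendsto.const_mul (1 - 2 * ε))
    have h4 : 0 < 1 - ε - (1 - 2 * ε) * 1 := by linarith [hε.1]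
    filter_upwards [h3.eventually_const_lt h4, eventually_gt_atTop 0,
      hqk.eventually (eventually_nhdsGT_zero_Ioc one_pos)] with n h5 hn h6
    have hn : (0 : ℝ) < n := Nat.cast_pos.2 hn
    have h7 := h.invRate_pos h6
    rw [mul_div, ← sub_div] at h5
    have h8 := (div_pos_iff_of_pos_right hn).1 h5
    simp only [Function.comp] at h7 h8
    linarith
  have h3 := h.le_of_invRate_le h.orbit_tendsto
    (Eventually.of_forall fun n => (h.iterate_mem_Icc le_rfl (hq _) _).2)
    (by linarith [hε.2]) hε1 h2
  have h4 := (h.error_tendsto_zero he hε.1 hfl).eventually_lt_const (sub_pos.2 hbb')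
  filter_upwards [h3, h4] with n h5 h6
  have hx := (h.orbit_mem n).1
  rw [div_lt_iff₀ hx] at h6
  set k := ⌊ε * (n : ℝ)⌋₊ with hk
  have hkn : k ≤ n := floor_mul_le hε'.2 n
  have h7 := h.le_iterate_add (q := fun i => q (k + i)) (he0 k) (fun i => hq _)
    (fun i => (hrec (k + i)).trans (by simpa using hanti (Nat.le_add_right k i))) (n - k)
  simp only [add_zero, Nat.add_sub_cancel' hkn] at h7
  have h8 : ((n - k : ℕ) : ℝ) * e k ≤ n * e k :=
    mul_le_mul_of_nonneg_right (Nat.cast_le.2 (Nat.sub_le n k)) (he0 k)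
  linarith

/-- The orbit of `y n ~ c x_{n-⌊an⌋}` after `⌊an⌋` steps, relative to `x_n`, where
`x` is the orbit of `1`. -/
theorem iterate_floor_tendsto (h : CritPert g α) {y : ℕ → ℝ} {a c : ℝ} (ha : a ∈ Set.Ioo (0 : ℝ) 1)
    (hc : 0 < c)
    (hy : Tendsto (fun n : ℕ => y n / (critStep g)^[n - ⌊a * (n : ℝ)⌋₊] 1) atTop (𝓝 c)) :
    Tendsto (fun n : ℕ => (critStep g)^[⌊a * (n : ℝ)⌋₊] (y n) / (critStep g)^[n] 1) atTop
      (𝓝 ((a + (1 - a) * c ^ (-α)) ^ (-1 / α))) := by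
  have ha' : a ∈ Set.Icc (0 : ℝ) 1 := ⟨ha.1.le, ha.2.le⟩
  have h1a : 0 < 1 - a := sub_pos.2 ha.2
  have hk := tendsto_sub_floor_div ha'
  have hxk := h.orbit_tendsto.comp (tendsto_atTop_of_div h1a hk)
  have hy0 : Tendsto y atTop (𝓝[>] 0) := by
    refine tendsto_nhdsWithin_iff.2 ⟨?_, ?_⟩
    · have := hy.mul (tendsto_nhdsWithin_iff.1 hxk).1
      rw [mul_zero] at this
      exact this.congr fun n => div_mul_cancel₀ _ (h.orbit_mem _).1.ne'
    · filter_upwards [hy.eventually_const_lt hc] with n hn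
      exact (div_pos_iff_of_pos_right (h.orbit_mem _).1).1 hn
  have h1 := (h.invRate_ratio hxk hc hy).mul (h.invRate_orbit_comp h1a hk)
  have h2 := (h.invRate_iterate_tendsto hy0 (tendsto_floor_div ha.1.le)).add h1
  have hy1 := hy0.eventually (eventually_nhdsGT_zero_Ioc one_pos)
  rw [mul_comm (c ^ (-α))] at h2
  refine h.tendsto_div_orbit ?_ ?_ (h2.congr' ?_)
  · refine tendsto_nhdsWithin_iff.2 ⟨?_, ?_⟩
    · refine squeeze_zero' ?_ ?_ (tendsto_nhdsWithin_iff.1 hy0).1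
      · filter_upwards [hy1] with n hn
        exact (h.iterate_mem_Ioc hn.2 ⟨hn.1, le_rfl⟩ _).1.le
      · filter_upwards [hy1] with n hn
        exact (h.iterate_mem_Ioc hn.2 ⟨hn.1, le_rfl⟩ _).2
    · filter_upwards [hy1] with n hn
      exact (h.iterate_mem_Ioc hn.2 ⟨hn.1, le_rfl⟩ _).1
  · have := mul_pos h1a (Real.rpow_pos_of_pos hc (-α))
    linarith [ha.1]
  · filter_upwards [eventually_gt_atTop 0] with n hn
    have hn : (n : ℝ) ≠ 0 := Nat.cast_ne_zero.2 hn.ne'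
    have := (h.invRate_pos (h.orbit_mem (n - ⌊a * (n : ℝ)⌋₊))).ne'
    simp only [Function.comp]
    field_simp
    ring

end CritPert

attribute [local instance] GWSetup.mΩ GWSetup.hprob1 GWSetup.hprob2

theorem zero_pow_eq_indicator {Ω : Type*} (Z : Ω → ℕ) (ω : Ω) :
    (0 : ℝ) ^ Z ω = 1 - {ω | Z ω ≠ 0}.indicator 1 ω := by
  by_cases h : Z ω = 0 <;> simp [h]

theorem one_sub_integral_indicator {Ω : Type*} [MeasurableSpace Ω] (P : Measure Ω)
    [IsProbabilityMeasure P] {E : Set Ω} (hE : MeasurableSet E) :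
    ∫ ω, (1 - E.indicator (1 : Ω → ℝ) ω) ∂P = 1 - (P E).toReal := by
  have hi : Integrable (E.indicator (1 : Ω → ℝ)) P := (integrable_const (1 : ℝ)).indicator hE
  rw [integral_sub (integrable_const _) hi, integral_indicator_one hE]
  simp [Measure.real]

theorem one_sub_le_pow {s : ℝ} (hs : s ∈ Set.Icc (0 : ℝ) 1) (k : ℕ) :
    1 - k * (1 - s) ≤ s ^ k := by
  have := one_add_mul_le_pow (a := s - 1) (by linarith [hs.1]) k
  rw [add_sub_cancel] at this
  linarith

theorem pow_mem_Icc {s : ℝ} (hs : s ∈ Set.Icc (0 : ℝ) 1) (k : ℕ) :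
    s ^ k ∈ Set.Icc (0 : ℝ) 1 := ⟨pow_nonneg hs.1 k, pow_le_one₀ hs.1 hs.2⟩

theorem pow_mul_pow_mem_Icc {s t : ℝ} (hs : s ∈ Set.Icc (0 : ℝ) 1) (ht : t ∈ Set.Icc (0 : ℝ) 1)
    (k l : ℕ) : s ^ k * t ^ l ∈ Set.Icc (0 : ℝ) 1 :=
  ⟨mul_nonneg (pow_mem_Icc hs k).1 (pow_mem_Icc ht l).1,
    mul_le_one₀ (pow_mem_Icc hs k).2 (pow_mem_Icc ht l).1 (pow_mem_Icc ht l).2⟩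

theorem integrable_of_mem_Icc {Ω : Type*} [MeasurableSpace Ω] {P : Measure Ω}
    [IsProbabilityMeasure P] {f : Ω → ℝ} (hf : Measurable f)
    (h : ∀ ω, f ω ∈ Set.Icc (0 : ℝ) 1) : Integrable f P := by
  refine Integrable.of_bound hf.aestronglyMeasurable 1 (Eventually.of_forall fun ω => ?_)
  rw [Real.norm_of_nonneg (h ω).1]
  exact (h ω).2

theorem integral_mem_Icc {Ω : Type*} [MeasurableSpace Ω] {P : Measure Ω}
    [IsProbabilityMeasure P] {f : Ω → ℝ} (hf : Measurable f)
    (h : ∀ ω, f ω ∈ Set.Icc (0 : ℝ) 1) : ∫ ω, f ω ∂P ∈ Set.Icc (0 : ℝ) 1 := by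
  refine ⟨integral_nonneg fun ω => (h ω).1, ?_⟩
  have := integral_mono (integrable_of_mem_Icc (P := P) hf h) (integrable_const (1 : ℝ))
    fun ω => (h ω).2
  simpa using this

namespace GWSetup

variable (S : GWSetup)

theorem measurable_pow_Z1 (n : ℕ) (s : ℝ) : Measurable fun ω => s ^ S.Z1 n ω :=
  (measurable_from_top (f := fun k : ℕ => s ^ k)).comp (S.mZ1 n)

theorem measurable_pow_Z2 (n : ℕ) (s : ℝ) : Measurable fun ω => s ^ S.Z2 n ω :=
  (measurable_from_top (f := fun k : ℕ => s ^ k)).comp (S.mZ2 n)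

theorem measurable_pow_Z (n : ℕ) (s t : ℝ) :
    Measurable fun ω => s ^ S.Z1 n ω * t ^ S.Z2 n ω :=
  (S.measurable_pow_Z1 n s).mul (S.measurable_pow_Z2 n t)

theorem measurableSet_surv (n : ℕ) : MeasurableSet (S.surv n) := by
  have h1 : MeasurableSet {ω | S.Z1 n ω ≠ 0} :=
    (S.mZ1 n) (MeasurableSet.of_discrete (s := {k : ℕ | k ≠ 0}))
  have h2 : MeasurableSet {ω | S.Z2 n ω ≠ 0} :=
    (S.mZ2 n) (MeasurableSet.of_discrete (s := {k : ℕ | k ≠ 0}))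
  exact h1.union h2

variable {s s' t t' : ℝ}

theorem F1_mem (n : ℕ) (hs : s ∈ Set.Icc (0 : ℝ) 1) : S.F1 n s ∈ Set.Icc (0 : ℝ) 1 :=
  integral_mem_Icc (S.measurable_pow_Z1 n s) fun _ => pow_mem_Icc hs _

theorem F21_mem (n : ℕ) (hs : s ∈ Set.Icc (0 : ℝ) 1) (ht : t ∈ Set.Icc (0 : ℝ) 1) :
    S.F21 n s t ∈ Set.Icc (0 : ℝ) 1 :=
  integral_mem_Icc (S.measurable_pow_Z n s t) fun _ => pow_mul_pow_mem_Icc hs ht _ _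

theorem integrable_pow_Z1 (n : ℕ) (hs : s ∈ Set.Icc (0 : ℝ) 1) :
    Integrable (fun ω => s ^ S.Z1 n ω) S.P1 :=
  integrable_of_mem_Icc (S.measurable_pow_Z1 n s) fun _ => pow_mem_Icc hs _

theorem integrable_pow_Z (n : ℕ) (hs : s ∈ Set.Icc (0 : ℝ) 1) (ht : t ∈ Set.Icc (0 : ℝ) 1) :
    Integrable (fun ω => s ^ S.Z1 n ω * t ^ S.Z2 n ω) S.P2 :=
  integrable_of_mem_Icc (S.measurable_pow_Z n s t) fun _ => pow_mul_pow_mem_Icc hs ht _ _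

theorem F1_mono (n : ℕ) (hs : s ∈ Set.Icc (0 : ℝ) 1) (hs' : s' ∈ Set.Icc (0 : ℝ) 1)
    (h : s ≤ s') : S.F1 n s ≤ S.F1 n s' :=
  integral_mono (S.integrable_pow_Z1 n hs) (S.integrable_pow_Z1 n hs')
    fun _ => pow_le_pow_left₀ hs.1 h _

theorem F21_mono (n : ℕ) (hs : s ∈ Set.Icc (0 : ℝ) 1) (hs' : s' ∈ Set.Icc (0 : ℝ) 1)
    (ht : t ∈ Set.Icc (0 : ℝ) 1) (ht' : t' ∈ Set.Icc (0 : ℝ) 1) (h : s ≤ s') (h' : t ≤ t') :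
    S.F21 n s t ≤ S.F21 n s' t' :=
  integral_mono (S.integrable_pow_Z n hs ht) (S.integrable_pow_Z n hs' ht')
    fun _ => mul_le_mul (pow_le_pow_left₀ hs.1 h _) (pow_le_pow_left₀ ht.1 h' _)
      (pow_mem_Icc ht _).1 (pow_mem_Icc hs' _).1

theorem F1_add (m n : ℕ) (hs : s ∈ Set.Icc (0 : ℝ) 1) :
    S.F1 (m + n) s = S.F1 m (S.F1 n s) := S.hbranch1 m n s hs.1 hs.2

theorem F21_add (m n : ℕ) (hs : s ∈ Set.Icc (0 : ℝ) 1) (ht : t ∈ Set.Icc (0 : ℝ) 1) :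
    S.F21 (m + n) s t = S.F21 m (S.F1 n s) (S.F21 n s t) :=
  S.hbranch2 m n s t hs.1 hs.2 ht.1 ht.2

theorem F1_zero (s : ℝ) : S.F1 0 s = s := by
  have : (fun ω => s ^ S.Z1 0 ω) =ᵐ[S.P1] fun _ => s := by
    filter_upwards [S.hinit1] with ω hω
    rw [hω.1, pow_one]
  rw [F1, integral_congr_ae this]
  simp

theorem F21_zero (s t : ℝ) : S.F21 0 s t = t := by
  have : (fun ω => s ^ S.Z1 0 ω * t ^ S.Z2 0 ω) =ᵐ[S.P2] fun _ => t := by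
    filter_upwards [S.hinit2] with ω hω
    rw [hω.1, hω.2, pow_one, pow_zero, one_mul]
  rw [F21, integral_congr_ae this]
  simp

theorem F1_one (n : ℕ) : S.F1 n 1 = 1 := by simp [F1]

theorem Q1_eq (n : ℕ) : S.Q1 n = 1 - S.F1 n 0 := by
  have hE : MeasurableSet {ω | S.Z1 n ω ≠ 0} :=
    (S.mZ1 n) (MeasurableSet.of_discrete (s := {k : ℕ | k ≠ 0}))
  simp only [F1, zero_pow_eq_indicator (S.Z1 n)]
  rw [one_sub_integral_indicator _ hE, Q1]
  ring

theorem Q2_eq (n : ℕ) : S.Q2 n = 1 - S.F21 n 1 0 := by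
  have hE : MeasurableSet {ω | S.Z2 n ω ≠ 0} :=
    (S.mZ2 n) (MeasurableSet.of_discrete (s := {k : ℕ | k ≠ 0}))
  simp only [F21, one_pow, one_mul, zero_pow_eq_indicator (S.Z2 n)]
  rw [one_sub_integral_indicator _ hE, Q2]
  ring

theorem Q21_eq (n : ℕ) : S.Q21 n = 1 - S.F21 n 0 0 := by
  have h (ω : S.Ω) : (0 : ℝ) ^ S.Z1 n ω * 0 ^ S.Z2 n ω = 1 - (S.surv n).indicator 1 ω := by
    rw [← pow_add, zero_pow_eq_indicator fun ω => S.Z1 n ω + S.Z2 n ω]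
    congr 2
    ext ω
    simp only [surv, Set.mem_ofPred_eq, ne_eq, Nat.add_eq_zero_iff, not_and_or]
  simp only [F21, h]
  rw [one_sub_integral_indicator _ (S.measurableSet_surv n), Q21]
  ring

theorem zero_mem : (0 : ℝ) ∈ Set.Icc (0 : ℝ) 1 := ⟨le_rfl, zero_le_one⟩

theorem one_mem : (1 : ℝ) ∈ Set.Icc (0 : ℝ) 1 := ⟨zero_le_one, le_rfl⟩

theorem Q1_mem (n : ℕ) : S.Q1 n ∈ Set.Icc (0 : ℝ) 1 := by
  rw [Q1_eq]
  exact Set.Icc.mem_iff_one_sub_mem.1 (S.F1_mem n zero_mem)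

theorem Q21_mem (n : ℕ) : S.Q21 n ∈ Set.Icc (0 : ℝ) 1 := by
  rw [Q21_eq]
  exact Set.Icc.mem_iff_one_sub_mem.1 (S.F21_mem n zero_mem zero_mem)

theorem le_F1 (n : ℕ) (hs : s ∈ Set.Icc (0 : ℝ) 1) : s ≤ S.F1 n s := by
  have h1 : s ≤ S.F1 1 s := by
    have hi : Integrable (fun ω => (S.Z1 1 ω : ℝ)) S.P1 := by
      by_contra h
      have := S.hcrit1
      rw [integral_undef h] at this
      norm_num at this
    have := integral_mono ((integrable_const (1 : ℝ)).sub (hi.mul_const (1 - s)))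
      (S.integrable_pow_Z1 1 hs) fun ω => one_sub_le_pow hs _
    simp only [Pi.sub_apply] at this
    rw [integral_sub (integrable_const _) (hi.mul_const _), integral_mul_const, S.hcrit1] at this
    simp only [integral_const, probReal_univ, smul_eq_mul] at this
    rw [F1]
    linarith
  induction n with
  | zero => rw [F1_zero]
  | succ n ih =>
    rw [F1_add _ _ _ hs]
    exact ih.trans (S.F1_mono n hs (S.F1_mem 1 hs) h1)

theorem antitone_Q1 : Antitone S.Q1 := by
  refine antitone_nat_of_succ_le fun n => ?_
  rw [Q1_eq, Q1_eq, F1_add _ _ _ zero_mem]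
  have := S.F1_mono n zero_mem (S.F1_mem 1 zero_mem) (S.F1_mem 1 zero_mem).1
  linarith

theorem antitone_Q21 : Antitone S.Q21 := by
  refine antitone_nat_of_succ_le fun n => ?_
  rw [Q21_eq, Q21_eq, F21_add _ _ _ zero_mem zero_mem]
  have := S.F21_mono n zero_mem (S.F1_mem 1 zero_mem) zero_mem (S.F21_mem 1 zero_mem zero_mem)
    (S.F1_mem 1 zero_mem).1 (S.F21_mem 1 zero_mem zero_mem).1
  linarith

/-- The deviation `F₂(1 - x) - (1 - x)` of the type-2 offspring generating function from the
identity. -/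
noncomputable def deviation (x : ℝ) : ℝ := x - (1 - S.F21 1 1 (1 - x))

theorem critStep_deviation (x : ℝ) : critStep S.deviation x = 1 - S.F21 1 1 (1 - x) := by
  simp [critStep, deviation]

theorem deviation_eq {x : ℝ} (hx : x ∈ Set.Ioc (0 : ℝ) 1) :
    S.deviation x = x ^ (1 + S.α2) * S.L2 x := by
  have := S.hF2 1 (1 - x) zero_le_one le_rfl (by linarith [hx.2]) (by linarith [hx.1])
  rw [sub_sub_cancel, sub_self, mul_zero] at this
  rw [deviation, F21, this]
  ring

theorem critPert_deviation : CritPert S.deviation S.α2 where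
  pos := S.hα2.1
  zero := by simp [deviation, F21]
  nonneg := by
    intro x hx
    have hx' := Set.Icc.mem_iff_one_sub_mem.1 hx
    have hi : Integrable (fun ω => (S.Z2 1 ω : ℝ)) S.P2 := by
      by_contra h
      have := S.hcrit2
      rw [integral_undef h] at this
      norm_num at this
    have := integral_mono ((integrable_const (1 : ℝ)).sub (hi.mul_const (1 - (1 - x))))
      (S.integrable_pow_Z 1 one_mem hx') fun ω => by
        simpa only [Pi.sub_apply, one_pow, one_mul] using one_sub_le_pow hx' (S.Z2 1 ω)
    simp only [Pi.sub_apply] at this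
    rw [integral_sub (integrable_const _) (hi.mul_const _), integral_mul_const, S.hcrit2] at this
    simp only [integral_const, probReal_univ, smul_eq_mul] at this
    rw [deviation, F21]
    linarith
  conv := by
    refine ⟨convex_Icc 0 1, fun x hx y hy a b ha hb hab => ?_⟩
    have hx' := Set.Icc.mem_iff_one_sub_mem.1 hx
    have hy' := Set.Icc.mem_iff_one_sub_mem.1 hy
    have hxy' := (convex_Icc (0 : ℝ) 1) hx' hy' ha hb hab
    simp only [smul_eq_mul] at hxy' ⊢
    have he : 1 - (a * x + b * y) = a * (1 - x) + b * (1 - y) := by linear_combination -hab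
    have ix := (S.integrable_pow_Z 1 one_mem hx').const_mul a
    have iy := (S.integrable_pow_Z 1 one_mem hy').const_mul b
    have := integral_mono (S.integrable_pow_Z 1 one_mem hxy') (ix.add iy) fun ω => by
      have := (convexOn_pow (𝕜 := ℝ) (S.Z2 1 ω)).2 hx'.1 hy'.1 ha hb hab
      simpa using this
    simp only [Pi.add_apply] at this
    rw [integral_add ix iy, integral_const_mul, integral_const_mul] at this
    simp only [deviation, F21, he]
    linarith
  monoStep := by
    intro x hx y hy hxy
    simp only [critStep_deviation]
    have := S.F21_mono 1 one_mem one_mem (Set.Icc.mem_iff_one_sub_mem.1 hy)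
      (Set.Icc.mem_iff_one_sub_mem.1 hx) le_rfl (by linarith : 1 - y ≤ 1 - x)
    linarith
  rv := by
    intro c hc
    have h1 := (S.hL2 c hc).const_mul (c ^ (1 + S.α2))
    rw [mul_one] at h1
    refine h1.congr' ?_
    filter_upwards [eventually_nhdsGT_zero_Ioc one_pos,
      (tendsto_const_mul_nhdsGT_zero hc).eventually (eventually_nhdsGT_zero_Ioc one_pos)]
      with x hx hcx
    rw [S.deviation_eq hx, S.deviation_eq hcx, Real.mul_rpow hc.le hx.1.le]
    have := (Real.rpow_pos_of_pos hx.1 (1 + S.α2)).ne'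
    rw [mul_right_comm, mul_comm _ (x ^ (1 + S.α2)), mul_div_mul_left _ _ this]
    ring

theorem iterate_eq (n : ℕ) (ht : t ∈ Set.Icc (0 : ℝ) 1) :
    (critStep S.deviation)^[n] (1 - t) = 1 - S.F21 n 1 t := by
  induction n with
  | zero => simp [F21_zero]
  | succ n ih =>
    rw [Function.iterate_succ_apply', ih, critStep_deviation, add_comm n 1,
      F21_add _ _ _ one_mem ht, F1_one, sub_sub_cancel]

theorem Q2_eq_iterate (n : ℕ) : S.Q2 n = (critStep S.deviation)^[n] 1 := by
  rw [Q2_eq, ← S.iterate_eq n zero_mem, sub_zero]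

theorem one_sub_F21_one_le (hs : s ∈ Set.Icc (0 : ℝ) 1) (ht : t ∈ Set.Icc (0 : ℝ) 1) :
    1 - S.F21 1 s t ≤ critStep S.deviation (1 - t) + S.A21 * (1 - s) := by
  have hi : Integrable (fun ω => (S.Z1 1 ω : ℝ)) S.P2 := by
    by_contra h
    have := S.hmean21
    rw [integral_undef h] at this
    exact S.hA21.ne this
  have := integral_mono ((S.integrable_pow_Z 1 one_mem ht).sub (hi.mul_const (1 - s)))
    (S.integrable_pow_Z 1 hs ht) fun ω => by
      have h1 := one_sub_le_pow hs (S.Z1 1 ω)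
      have h2 := pow_mem_Icc ht (S.Z2 1 ω)
      have h3 := pow_mem_Icc hs (S.Z1 1 ω)
      simp only [Pi.sub_apply, one_pow, one_mul]
      nlinarith [h2.1, h2.2, h3.1, h3.2]
  simp only [Pi.sub_apply] at this
  rw [integral_sub (S.integrable_pow_Z 1 one_mem ht) (hi.mul_const _), integral_mul_const,
    S.hmean21] at this
  rw [critStep_deviation, sub_sub_cancel, F21, F21]
  linarith

theorem one_sub_F21_succ_le (n : ℕ) (hs : s ∈ Set.Icc (0 : ℝ) 1) (ht : t ∈ Set.Icc (0 : ℝ) 1) :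
    1 - S.F21 (n + 1) s t ≤
      critStep S.deviation (1 - S.F21 n s t) + S.A21 * (1 - S.F1 n s) := by
  rw [add_comm n 1, F21_add _ _ _ hs ht]
  exact S.one_sub_F21_one_le (S.F1_mem n hs) (S.F21_mem n hs ht)

theorem one_sub_F21_le (n : ℕ) (hs : s ∈ Set.Icc (0 : ℝ) 1) (ht : t ∈ Set.Icc (0 : ℝ) 1) :
    1 - S.F21 n s t ≤
      (critStep S.deviation)^[n] (1 - t) + n * (S.A21 * (1 - s)) := by
  have := S.critPert_deviation.le_iterate_add (q := fun n => 1 - S.F21 n s t)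
    (mul_nonneg S.hA21.le (sub_nonneg.2 hs.2))
    (fun i => Set.Icc.mem_iff_one_sub_mem.1 (S.F21_mem i hs ht))
    (fun i => (S.one_sub_F21_succ_le i hs ht).trans ?_) n
  · simpa only [F21_zero] using this
  · have := mul_le_mul_of_nonneg_left (sub_le_sub_left (S.le_F1 i hs) 1) S.hA21.le
    linarith

theorem iterate_le_one_sub_F21 (n : ℕ) (hs : s ∈ Set.Icc (0 : ℝ) 1)
    (ht : t ∈ Set.Icc (0 : ℝ) 1) :
    (critStep S.deviation)^[n] (1 - t) ≤ 1 - S.F21 n s t := by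
  rw [S.iterate_eq n ht]
  linarith [S.F21_mono n hs one_mem ht ht hs.2 le_rfl]

theorem Ered_eq {m n : ℕ} (hmn : m ≤ n) (hQ : S.Q21 n ≠ 0) (hs : s ∈ Set.Icc (0 : ℝ) 1)
    (ht : t ∈ Set.Icc (0 : ℝ) 1) :
    S.Ered m n (fun k l => s ^ k * t ^ l) =
      1 - (1 - S.F21 m (1 - (1 - s) * S.Q1 (n - m)) (1 - (1 - t) * S.Q21 (n - m))) /
        S.Q21 n := by
  have hm : Measurable fun ω => s ^ S.R1 m n ω * t ^ S.R2 m n ω :=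
    ((measurable_from_top (f := fun k : ℕ => s ^ k)).comp (S.mR1 m n)).mul
      ((measurable_from_top (f := fun k : ℕ => t ^ k)).comp (S.mR2 m n))
  have hi : Integrable (fun ω => s ^ S.R1 m n ω * t ^ S.R2 m n ω) S.P2 :=
    integrable_of_mem_Icc hm fun _ => pow_mul_pow_mem_Icc hs ht _ _
  have h1 := integral_add_compl (S.measurableSet_surv n) hi
  have h2 : ∫ ω in (S.surv n)ᶜ, s ^ S.R1 m n ω * t ^ S.R2 m n ω ∂S.P2 = 1 - S.Q21 n := by
    rw [setIntegral_congr_ae (g := fun _ => (1 : ℝ)) (S.measurableSet_surv n).compl]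
    · rw [setIntegral_const, smul_eq_mul, mul_one, probReal_compl_eq_one_sub
        (S.measurableSet_surv n)]
      rfl
    · filter_upwards [S.hext m n] with ω hω hmem
      simp only [surv, Set.mem_compl_iff, Set.mem_ofPred_eq, not_or, not_not] at hmem
      rw [(hω hmem).1, (hω hmem).2, pow_zero, pow_zero, one_mul]
  have h3 := S.hreduced m n hmn s t hs.1 hs.2 ht.1 ht.2
  change _ = S.F21 m (1 - (1 - s) * S.Q1 (n - m)) (1 - (1 - t) * S.Q21 (n - m)) at h3
  rw [Ered, eq_sub_iff_add_eq, ← add_div, div_eq_one_iff_eq hQ]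
  linarith

theorem Q2_pos (n : ℕ) : 0 < S.Q2 n := by
  rw [Q2_eq_iterate]
  exact (S.critPert_deviation.orbit_mem n).1

theorem Q2_le_Q21 (n : ℕ) : S.Q2 n ≤ S.Q21 n := by
  rw [Q2_eq_iterate, Q21_eq]
  simpa using S.iterate_le_one_sub_F21 n zero_mem zero_mem

variable {S}

theorem CondA.Q1_tendsto (hA : S.CondA) : Tendsto S.Q1 atTop (𝓝 0) := by
  refine squeeze_zero' (Eventually.of_forall fun n => (S.Q1_mem n).1) ?_ hA
  filter_upwards [eventually_ge_atTop 1] with n hn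
  have hn : (1 : ℝ) ≤ n := Nat.one_le_cast.2 hn
  have h1 := (S.Q1_mem n).1
  have h2 : S.Q2 n ≤ 1 := (S.Q2_le_Q21 n).trans (S.Q21_mem n).2
  rw [le_div_iff₀ (S.Q2_pos n)]
  nlinarith [S.Q2_pos n]

theorem CondA.error_tendsto (hA : S.CondA) :
    Tendsto (fun n : ℕ => n * (S.A21 * S.Q1 n) / (critStep S.deviation)^[n] 1) atTop (𝓝 0) := by
  have := Tendsto.const_mul S.A21 hA
  rw [mul_zero] at this
  refine this.congr fun n => ?_
  rw [Q2_eq_iterate]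
  ring

theorem CondA.Q21_div_Q2_tendsto (hA : S.CondA) :
    Tendsto (fun n => S.Q21 n / S.Q2 n) atTop (𝓝 1) := by
  have hrec (i : ℕ) : S.Q21 (i + 1) ≤ critStep S.deviation (S.Q21 i) + S.A21 * S.Q1 i := by
    rw [Q21_eq, Q21_eq, Q1_eq]
    exact S.one_sub_F21_succ_le i zero_mem zero_mem
  have he := hA.Q1_tendsto.const_mul S.A21
  rw [mul_zero] at he
  have h0 : Tendsto S.Q21 atTop (𝓝[>] 0) := tendsto_nhdsWithin_iff.2
    ⟨S.critPert_deviation.tendsto_zero_of_le_step S.Q21_mem S.antitone_Q21 he hrec,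
      Eventually.of_forall fun n => (S.Q2_pos n).trans_le (S.Q2_le_Q21 n)⟩
  rw [tendsto_order]
  constructor
  · intro b hb
    refine Eventually.of_forall fun n => hb.trans_le ?_
    rw [one_le_div (S.Q2_pos n)]
    exact S.Q2_le_Q21 n
  · intro b hb
    obtain ⟨b', hb1, hbb'⟩ := exists_between hb
    filter_upwards [S.critPert_deviation.perturbed_le S.Q21_mem h0
      (fun i => mul_nonneg S.hA21.le (S.Q1_mem i).1)
      (S.antitone_Q1.const_mul S.hA21.le) hrec hA.error_tendsto hb1] with n hn
    rw [← Q2_eq_iterate] at hn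
    rw [div_lt_iff₀ (S.Q2_pos n)]
    nlinarith [S.Q2_pos n]

end GWSetup

/-- Theorem `T_ZubQ1`(1).  Under Condition (A), for any
`s₁, s₂ ∈ (0,1)` and `a ∈ (0,1)`,
`E[s₁^{Z₁(⌊an⌋,n)} s₂^{Z₂(⌊an⌋,n)} | Z(n) ≠ 0, Z(0) = e₂]
  → 1 - (a + (1-a)(1-s₂)^{-α₂})^{-1/α₂}`. -/
theorem condA_linear_reduced_pgf (S : GWSetup) (hA : S.CondA)
    (s1 s2 : ℝ) (hs1 : s1 ∈ Set.Ioo (0 : ℝ) 1) (hs2 : s2 ∈ Set.Ioo (0 : ℝ) 1)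
    (a : ℝ) (ha : a ∈ Set.Ioo (0 : ℝ) 1) :
    Filter.Tendsto
      (fun n : ℕ => S.Ered ⌊a * (n : ℝ)⌋₊ n (fun k l => s1 ^ k * s2 ^ l))
      Filter.atTop
      (nhds (1 - (a + (1 - a) * (1 - s2) ^ (-S.α2)) ^ (-1 / S.α2))) := by
  have hs : s1 ∈ Set.Icc (0 : ℝ) 1 := Set.Ioo_subset_Icc_self hs1
  have ht : s2 ∈ Set.Icc (0 : ℝ) 1 := Set.Ioo_subset_Icc_self hs2
  have hcp := S.critPert_deviation
  have h1a : 0 < 1 - a := sub_pos.2 ha.2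
  have hk := CritPert.tendsto_sub_floor_div (Set.Ioo_subset_Icc_self ha)
  have hy : Tendsto (fun n : ℕ => (1 - s2) * S.Q21 (n - ⌊a * (n : ℝ)⌋₊) /
      (critStep S.deviation)^[n - ⌊a * (n : ℝ)⌋₊] 1) atTop (𝓝 (1 - s2)) := by
    have := (hA.Q21_div_Q2_tendsto.comp (CritPert.tendsto_atTop_of_div h1a hk)).const_mul (1 - s2)
    rw [mul_one] at this
    refine this.congr fun n => ?_
    rw [← S.Q2_eq_iterate, mul_div_assoc]
    rfl
  have hlow := hcp.iterate_floor_tendsto ha (sub_pos.2 hs2.2) hy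
  have herr := hcp.error_tendsto_zero hA.error_tendsto h1a hk
  have hup := hlow.add herr
  rw [add_zero] at hup
  have hmem {r Q : ℝ} (hr : r ∈ Set.Icc (0 : ℝ) 1) (hQ : Q ∈ Set.Icc (0 : ℝ) 1) :
      1 - (1 - r) * Q ∈ Set.Icc (0 : ℝ) 1 := by
    have hr' := Set.Icc.mem_iff_one_sub_mem.1 hr
    exact Set.Icc.mem_iff_one_sub_mem.1
      ⟨mul_nonneg hr'.1 hQ.1, mul_le_one₀ hr'.2 hQ.1 hQ.2⟩
  have hD := tendsto_of_tendsto_of_tendsto_of_le_of_le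
    (f := fun n : ℕ => (1 - S.F21 ⌊a * (n : ℝ)⌋₊ (1 - (1 - s1) * S.Q1 (n - ⌊a * (n : ℝ)⌋₊))
      (1 - (1 - s2) * S.Q21 (n - ⌊a * (n : ℝ)⌋₊))) / (critStep S.deviation)^[n] 1) hlow hup
    (fun n => by
      have := S.iterate_le_one_sub_F21 ⌊a * (n : ℝ)⌋₊ (hmem hs (S.Q1_mem (n - ⌊a * (n : ℝ)⌋₊)))
        (hmem ht (S.Q21_mem (n - ⌊a * (n : ℝ)⌋₊)))
      rw [sub_sub_cancel] at this
      exact div_le_div_of_nonneg_right this (hcp.orbit_mem n).1.le)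
    (fun n => by
      have h1 := S.one_sub_F21_le ⌊a * (n : ℝ)⌋₊ (hmem hs (S.Q1_mem (n - ⌊a * (n : ℝ)⌋₊)))
        (hmem ht (S.Q21_mem (n - ⌊a * (n : ℝ)⌋₊)))
      rw [sub_sub_cancel, sub_sub_cancel] at h1
      simp only
      rw [← add_div]
      refine div_le_div_of_nonneg_right (h1.trans ?_) (hcp.orbit_mem n).1.le
      have hQ := (S.Q1_mem (n - ⌊a * (n : ℝ)⌋₊)).1
      have h2 : (⌊a * (n : ℝ)⌋₊ : ℝ) ≤ n := Nat.cast_le.2 (CritPert.floor_mul_le ha.2.le n)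
      have h3 : (1 - s1) * S.Q1 (n - ⌊a * (n : ℝ)⌋₊) ≤ S.Q1 (n - ⌊a * (n : ℝ)⌋₊) :=
        mul_le_of_le_one_left hQ (by linarith [hs.1])
      have h4 := mul_le_mul_of_nonneg_left h3 S.hA21.le
      have h5 := mul_le_mul h2 h4
        (mul_nonneg S.hA21.le (mul_nonneg (sub_nonneg.2 hs.2) hQ)) (Nat.cast_nonneg n)
      linarith)
  have hfin := (hD.div hA.Q21_div_Q2_tendsto one_ne_zero).const_sub 1
  rw [div_one] at hfin
  refine hfin.congr fun n => ?_
  have hx := S.Q2_pos n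
  rw [S.Ered_eq (CritPert.floor_mul_le ha.2.le n) (hx.trans_le (S.Q2_le_Q21 n)).ne' hs ht]
  simp only [Pi.div_apply]
  rw [← S.Q2_eq_iterate, div_div_div_cancel_right₀ hx.ne']
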